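/- arXiv:1206.1692 — 7 statements merged into one kernel-verified Lean document; each statement's English description precedes it below -/
import Mathlib

section
/- Under this setup, K = R' − (ψ₁+ψ₂)(S), where S is the bilinear form S(y,z) = (λ+εμ+ε/(4n))·t(y,z) + ((g(p,p)+g(q,q))/4)·g(y,z) + (g(p,q)/2)·g(y,Pz). (Pointwise algebraic form of Theorem 2.1.) -/
open scoped InnerProductSpace

noncomputable section

variable {V : Type*} [NormedAddCommGroup V] [InnerProductSpace ℝ V]

/-- The (0,4)-tensor `ψ₁(S)` associated to a bilinear form `S`. -/
def psi1 (S : V → V → ℝ) (x y z w : V) : ℝ :=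
  ⟪y, z⟫_ℝ * S x w - ⟪x, z⟫_ℝ * S y w + S y z * ⟪x, w⟫_ℝ - S x z * ⟪y, w⟫_ℝ

/-- The (0,4)-tensor `ψ₂(S)(x,y,z,w) = ψ₁(S)(x,y,Pz,Pw)`. -/
def psi2 (P : V →ₗ[ℝ] V) (S : V → V → ℝ) (x y z w : V) : ℝ :=
  psi1 S x y (P z) (P w)

/-- `π₁ = (1/2) ψ₁(g)`. -/
def pi1 (x y z w : V) : ℝ := (1 / 2) * psi1 (fun a b => ⟪a, b⟫_ℝ) x y z w

/-- `π₂ = (1/2) ψ₂(g)`. -/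
def pi2 (P : V →ₗ[ℝ] V) (x y z w : V) : ℝ :=
  (1 / 2) * psi2 P (fun a b => ⟪a, b⟫_ℝ) x y z w

/-- `π₃ = ψ₁(g̃)` where `g̃(x,y) = g(x,Py)`. -/
def pi3 (P : V →ₗ[ℝ] V) (x y z w : V) : ℝ :=
  psi1 (fun a b => ⟪a, P b⟫_ℝ) x y z w

/-- A (0,4)-tensor is curvature-like if it has the symmetries of a curvature tensor. -/
def CurvatureLike (L : V → V → V → V → ℝ) : Prop :=
  (∀ x y z w : V, L x y z w = - L y x z w) ∧
  (∀ x y z w : V, L x y z w = - L x y w z) ∧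
  (∀ x y z w : V, L x y z w + L y z x w + L z x y w = 0)

/-- A Riemannian P-tensor: a curvature-like tensor with `L(x,y,Pz,Pw) = L(x,y,z,w)`. -/
def IsRiemannianPTensor (P : V →ₗ[ℝ] V) (L : V → V → V → V → ℝ) : Prop :=
  CurvatureLike L ∧ ∀ x y z w : V, L x y (P z) (P w) = L x y z w

/-- The Ricci tensor `ρ(L)(y,z) = Σᵢ L(eᵢ,y,z,eᵢ)`. -/
def ricci {m : ℕ} (e : OrthonormalBasis (Fin m) ℝ V) (L : V → V → V → V → ℝ)
    (y z : V) : ℝ :=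
  ∑ i, L (e i) y z (e i)

/-- The scalar curvature `τ(L) = Σᵢ ρ(L)(eᵢ,eᵢ)`. -/
def tau {m : ℕ} (e : OrthonormalBasis (Fin m) ℝ V) (L : V → V → V → V → ℝ) : ℝ :=
  ∑ i, ricci e L (e i) (e i)

/-- The associated Ricci tensor `ρ*(L)(y,z) = Σᵢ L(eᵢ,y,z,Peᵢ)`. -/
def ricciStar {m : ℕ} (e : OrthonormalBasis (Fin m) ℝ V) (P : V →ₗ[ℝ] V)
    (L : V → V → V → V → ℝ) (y z : V) : ℝ :=
  ∑ i, L (e i) y z (P (e i))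

/-- The associated scalar curvature `τ*(L) = Σᵢ ρ*(L)(eᵢ,eᵢ)`. -/
def tauStar {m : ℕ} (e : OrthonormalBasis (Fin m) ℝ V) (P : V →ₗ[ℝ] V)
    (L : V → V → V → V → ℝ) : ℝ :=
  ∑ i, ricciStar e P L (e i) (e i)

/-- The Bochner tensor `B(L)` (for `n ≥ 3`). -/
def bochner {m : ℕ} (n : ℕ) (e : OrthonormalBasis (Fin m) ℝ V) (P : V →ₗ[ℝ] V)
    (L : V → V → V → V → ℝ) (x y z w : V) : ℝ :=
  L x y z w - (1 / (2 * ((n : ℝ) - 2))) *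
    ((psi1 (ricci e L) x y z w + psi2 P (ricci e L) x y z w)
      - (1 / (2 * ((n : ℝ) - 1))) *
        (tau e L * (pi1 x y z w + pi2 P x y z w) + tauStar e P L * pi3 P x y z w))

/-- The tensor `A(L) = L − (τ(L)/(4n(n−1)))·(π₁+π₂−ε·π₃)` (for `n ≥ 2`). -/
def Atens {m : ℕ} (n : ℕ) (ε : ℝ) (e : OrthonormalBasis (Fin m) ℝ V) (P : V →ₗ[ℝ] V)
    (L : V → V → V → V → ℝ) (x y z w : V) : ℝ :=
  L x y z w - (tau e L / (4 * (n : ℝ) * ((n : ℝ) - 1))) *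
    (pi1 x y z w + pi2 P x y z w - ε * pi3 P x y z w)

/-- The tensor `C(L) = L − (1/(4n(n−1)))·(τ(L)(π₁+π₂) + τ*(L)π₃)` (for `n ≥ 2`). -/
def Ctens {m : ℕ} (n : ℕ) (e : OrthonormalBasis (Fin m) ℝ V) (P : V →ₗ[ℝ] V)
    (L : V → V → V → V → ℝ) (x y z w : V) : ℝ :=
  L x y z w - (1 / (4 * (n : ℝ) * ((n : ℝ) - 1))) *
    (tau e L * (pi1 x y z w + pi2 P x y z w) + tauStar e P L * pi3 P x y z w)

/-- The tensor `E(L) = L − (τ(L)/(2n(2n−1)))·π₁`. -/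
def Etens {m : ℕ} (n : ℕ) (e : OrthonormalBasis (Fin m) ℝ V)
    (L : V → V → V → V → ℝ) (x y z w : V) : ℝ :=
  L x y z w - (tau e L / (2 * (n : ℝ) * (2 * (n : ℝ) - 1))) * pi1 x y z w

/-- `x, y` span a totally real 2-plane: `span{x,y} ⊥ span{Px,Py}`. -/
def TotallyReal (P : V →ₗ[ℝ] V) (x y : V) : Prop :=
  ⟪x, P x⟫_ℝ = 0 ∧ ⟪x, P y⟫_ℝ = 0 ∧ ⟪y, P x⟫_ℝ = 0 ∧ ⟪y, P y⟫_ℝ = 0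

/-- pointwise algebraic form of Theorem 2.1.
On a manifold of class W̄₃ ∪ W̄₆ with closed 1-form θ, the Riemannian P-tensor K
satisfies `K = R' − (ψ₁+ψ₂)(S)`. -/
theorem stmt_0
    [FiniteDimensional ℝ V] (n : ℕ) (hn : 1 ≤ n)
    (hdim : Module.finrank ℝ V = 2 * n)
    (P : V →ₗ[ℝ] V) (hP2 : ∀ x : V, P (P x) = x)
    (hPg : ∀ x y : V, ⟪P x, P y⟫_ℝ = ⟪x, y⟫_ℝ)
    (hPtr : LinearMap.trace ℝ V P = 0)
    (ε : ℝ) (hε : ε = 1 ∨ ε = -1)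
    (Ω : V) (hΩ : P Ω = ε • Ω)
    (lam mu : ℝ)
    (t : V →ₗ[ℝ] V →ₗ[ℝ] ℝ) (htsym : ∀ y z : V, t y z = t z y)
    (htP : ∀ y z : V, t y (P z) = ε * t y z)
    (R' : V →ₗ[ℝ] V →ₗ[ℝ] V →ₗ[ℝ] V →ₗ[ℝ] ℝ)
    (hR' : IsRiemannianPTensor P (fun x y z w => R' x y z w))
    (p q : V)
    (hp : p = (lam + ε * mu + ε / (2 * (n : ℝ))) • Ω)
    (hq : q = (mu + ε * lam) • Ω)
    (S' S'' : V → V → ℝ)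
    (hS' : ∀ y z : V, S' y z = (lam + ε * mu + ε / (2 * (n : ℝ))) * t y z
        - ((mu + ε * lam) / (2 * (n : ℝ))) * (⟪Ω, y⟫_ℝ * ⟪Ω, z⟫_ℝ))
    (hS'' : ∀ y z : V, S'' y z = (lam + ε * mu) * t y z
        + ((mu + ε * lam) / (2 * (n : ℝ))) * (⟪Ω, y⟫_ℝ * ⟪Ω, z⟫_ℝ))
    (R : V → V → V → V → ℝ)
    (hR : ∀ x y z w : V, R x y z w = R' x y z w - ⟪p, p⟫_ℝ * pi1 x y z w
        - ⟪q, q⟫_ℝ * pi2 P x y z w - ⟪p, q⟫_ℝ * pi3 P x y z w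
        - psi1 S' x y z w - psi2 P S'' x y z w)
    (K : V → V → V → V → ℝ)
    (hK : ∀ x y z w : V, K x y z w = (1 / 2) * (R x y z w + R x y (P z) (P w)))
    (S : V → V → ℝ)
    (hS : ∀ y z : V, S y z = (lam + ε * mu + ε / (4 * (n : ℝ))) * t y z
        + ((⟪p, p⟫_ℝ + ⟪q, q⟫_ℝ) / 4) * ⟪y, z⟫_ℝ + (⟪p, q⟫_ℝ / 2) * ⟪y, P z⟫_ℝ) :
    ∀ x y z w : V, K x y z w = R' x y z w - (psi1 S x y z w + psi2 P S x y z w) := by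
  intro x y z w
  have h1 : R' x y (P z) (P w) = R' x y z w := hR'.2 x y z w
  rw [hK, hR, hR]
  simp only [pi1, pi2, pi3, psi2, psi1, hP2, hS, hS', hS'', h1]
  ring
end
end

section
/- Let n ≥ 3, let K and R' be Riemannian P-tensors on V, and let S be a bilinear form on V with S(y,z) = S(z,y) and S(y,Pz) = S(z,Py) for all y,z, such that K = R' − (ψ₁+ψ₂)(S). Then B(R') = B(K). (Pointwise algebraic form of Theorem 3.1: the Bochner tensor of the curvature of any natural connection on a manifold of class W̄₃ ∪ W̄₆ with closed 1-form θ, dim M ≥ 6, equals the Bochner tensor of the Riemannian P-tensor K.) -/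
open scoped InnerProductSpace

noncomputable section

variable {V : Type*} [NormedAddCommGroup V] [InnerProductSpace ℝ V]

/-- Expansion of a linear functional in an orthonormal basis. -/
lemma sum_inner_mul_apply {m : ℕ} (e : OrthonormalBasis (Fin m) ℝ V) (f : V →ₗ[ℝ] ℝ) (z : V) :
    ∑ i, ⟪e i, z⟫_ℝ * f (e i) = f z := by
  conv_rhs => rw [← e.sum_repr' z]
  simp [map_sum]

/-- Pieces of the trace computations. -/
lemma sum_inner_P {m : ℕ} (e : OrthonormalBasis (Fin m) ℝ V) (P : V →ₗ[ℝ] V)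
    (hPtr : LinearMap.trace ℝ V P = 0) : ∑ i, ⟪e i, P (e i)⟫_ℝ = 0 := by
  rw [← hPtr, LinearMap.trace_eq_sum_inner P e]

lemma sum_inner_self {m : ℕ} (e : OrthonormalBasis (Fin m) ℝ V) :
    ∑ i, ⟪e i, e i⟫_ℝ = (m : ℝ) := by
  simp

lemma ricci_psi {m : ℕ} (e : OrthonormalBasis (Fin m) ℝ V)
    (P : V →ₗ[ℝ] V) (hP2 : ∀ x : V, P (P x) = x)
    (hPg : ∀ x y : V, ⟪P x, y⟫_ℝ = ⟪x, P y⟫_ℝ)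
    (hPtr : LinearMap.trace ℝ V P = 0)
    (S : V →ₗ[ℝ] V →ₗ[ℝ] ℝ)
    (hSsym : ∀ y z : V, S y z = S z y)
    (hSP : ∀ y z : V, S y (P z) = S z (P y)) (y z : V) :
    ∑ i, (psi1 (fun a b => S a b) (e i) y z (e i) + psi2 P (fun a b => S a b) (e i) y z (e i))
      = ⟪y, z⟫_ℝ * ∑ i, S (e i) (e i) + ⟪y, P z⟫_ℝ * ∑ i, S (e i) (P (e i))
        + ((m : ℝ) - 4) * S y z := by
  have h1 := sum_inner_mul_apply e (S y) z
  have h2 := sum_inner_mul_apply e (S.flip z) y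
  have h3 := sum_inner_mul_apply e ((S y).comp P) (P z)
  have h4 := sum_inner_mul_apply e (S.flip (P z)) (P y)
  have h5 := sum_inner_P e P hPtr
  have h6 := sum_inner_self e
  simp only [LinearMap.flip_apply, LinearMap.comp_apply, hP2] at h1 h2 h3 h4
  have h7 : S (P y) (P z) = S y z := by rw [hSP, hP2, hSsym]
  have hc : ∀ i, ⟪y, P (e i)⟫_ℝ = ⟪e i, P y⟫_ℝ := fun i => by
    rw [← hPg, real_inner_comm]
  have hc' : ∀ i, ⟪y, e i⟫_ℝ = ⟪e i, y⟫_ℝ := fun i => real_inner_comm _ _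
  have key : ∀ i, psi1 (fun a b => S a b) (e i) y z (e i)
      + psi2 P (fun a b => S a b) (e i) y z (e i) =
      ⟪y, z⟫_ℝ * S (e i) (e i) - ⟪e i, z⟫_ℝ * S y (e i) + S y z * ⟪e i, e i⟫_ℝ
      - ⟪e i, y⟫_ℝ * S (e i) z + (⟪y, P z⟫_ℝ * S (e i) (P (e i))
      - ⟪e i, P z⟫_ℝ * S y (P (e i)) + S y (P z) * ⟪e i, P (e i)⟫_ℝ
      - ⟪e i, P y⟫_ℝ * S (e i) (P z)) := fun i => by
    simp only [psi1, psi2, hc, hc']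
    ring
  simp only [key, Finset.sum_add_distrib, Finset.sum_sub_distrib, ← Finset.mul_sum,
    h1, h2, h3, h4, h5, h6, h7]
  ring

lemma ricciStar_psi {m : ℕ} (e : OrthonormalBasis (Fin m) ℝ V)
    (P : V →ₗ[ℝ] V) (hP2 : ∀ x : V, P (P x) = x)
    (hPg : ∀ x y : V, ⟪P x, y⟫_ℝ = ⟪x, P y⟫_ℝ)
    (hPtr : LinearMap.trace ℝ V P = 0)
    (S : V →ₗ[ℝ] V →ₗ[ℝ] ℝ)
    (hSsym : ∀ y z : V, S y z = S z y)
    (hSP : ∀ y z : V, S y (P z) = S z (P y)) (y z : V) :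
    ∑ i, (psi1 (fun a b => S a b) (e i) y z (P (e i))
        + psi2 P (fun a b => S a b) (e i) y z (P (e i)))
      = ⟪y, z⟫_ℝ * ∑ i, S (e i) (P (e i)) + ⟪y, P z⟫_ℝ * ∑ i, S (e i) (e i)
        + ((m : ℝ) - 4) * S y (P z) := by
  have h := ricci_psi e P hP2 hPg hPtr S hSsym hSP y (P z)
  have hswap : ∀ i, psi1 (fun a b => S a b) (e i) y z (P (e i))
        + psi2 P (fun a b => S a b) (e i) y z (P (e i)) =
      psi1 (fun a b => S a b) (e i) y (P z) (e i)
        + psi2 P (fun a b => S a b) (e i) y (P z) (e i) := fun i => by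
    simp only [psi2, hP2]
    ring
  simp only [hswap, h, hP2]
  ring

/-- pointwise algebraic form of Theorem 3.1.
If `K = R' − (ψ₁+ψ₂)(S)` for Riemannian P-tensors `K`, `R'` and a bilinear form `S`
with `S(y,z) = S(z,y)` and `S(y,Pz) = S(z,Py)`, then the Bochner tensors coincide:
`B(R') = B(K)` (dim M = 2n ≥ 6). -/
theorem stmt_1
    [FiniteDimensional ℝ V] (n : ℕ) (hn : 3 ≤ n)
    (hdim : Module.finrank ℝ V = 2 * n)
    (P : V →ₗ[ℝ] V) (hP2 : ∀ x : V, P (P x) = x)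
    (hPg : ∀ x y : V, ⟪P x, P y⟫_ℝ = ⟪x, y⟫_ℝ)
    (hPtr : LinearMap.trace ℝ V P = 0)
    (e : OrthonormalBasis (Fin (2 * n)) ℝ V)
    (K R' : V →ₗ[ℝ] V →ₗ[ℝ] V →ₗ[ℝ] V →ₗ[ℝ] ℝ)
    (hK : IsRiemannianPTensor P (fun x y z w => K x y z w))
    (hR' : IsRiemannianPTensor P (fun x y z w => R' x y z w))
    (S : V →ₗ[ℝ] V →ₗ[ℝ] ℝ)
    (hSsym : ∀ y z : V, S y z = S z y)
    (hSP : ∀ y z : V, S y (P z) = S z (P y))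
    (hKR : ∀ x y z w : V, K x y z w = R' x y z w
        - (psi1 (fun a b => S a b) x y z w + psi2 P (fun a b => S a b) x y z w)) :
    ∀ x y z w : V,
      bochner n e P (fun a b c d => R' a b c d) x y z w
        = bochner n e P (fun a b c d => K a b c d) x y z w := by
  have hPs : ∀ x y : V, ⟪P x, y⟫_ℝ = ⟪x, P y⟫_ℝ := fun x y => by
    rw [← hPg x (P y), hP2]
  obtain ⟨t, ht⟩ : ∃ t, t = ∑ i, S (e i) (e i) := ⟨_, rfl⟩
  obtain ⟨s, hs⟩ : ∃ s, s = ∑ i, S (e i) (P (e i)) := ⟨_, rfl⟩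
  have hric : ∀ y z, ricci e (fun a b c d => K a b c d) y z =
      ricci e (fun a b c d => R' a b c d) y z
        - (⟪y, z⟫_ℝ * t + ⟪y, P z⟫_ℝ * s + (2 * (n : ℝ) - 4) * S y z) := fun y z => by
    have h := ricci_psi e P hP2 hPs hPtr S hSsym hSP y z
    rw [← ht, ← hs] at h
    push_cast at h
    simp only [ricci, hKR]
    rw [Finset.sum_sub_distrib, h]
  have hricS : ∀ y z, ricciStar e P (fun a b c d => K a b c d) y z =
      ricciStar e P (fun a b c d => R' a b c d) y z
        - (⟪y, z⟫_ℝ * s + ⟪y, P z⟫_ℝ * t + (2 * (n : ℝ) - 4) * S y (P z)) := fun y z => by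
    have h := ricciStar_psi e P hP2 hPs hPtr S hSsym hSP y z
    rw [← ht, ← hs] at h
    push_cast at h
    simp only [ricciStar, hKR]
    rw [Finset.sum_sub_distrib, h]
  have h5 := sum_inner_P e P hPtr
  have h6 := sum_inner_self e
  push_cast at h6
  have htau : tau e (fun a b c d => K a b c d) =
      tau e (fun a b c d => R' a b c d) - 4 * ((n : ℝ) - 1) * t := by
    simp only [tau, hric, Finset.sum_sub_distrib, Finset.sum_add_distrib, ← Finset.mul_sum,
      ← Finset.sum_mul, h5, h6, ← ht]
    ring
  have htauS : tauStar e P (fun a b c d => K a b c d) =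
      tauStar e P (fun a b c d => R' a b c d) - 4 * ((n : ℝ) - 1) * s := by
    simp only [tauStar, hricS, Finset.sum_sub_distrib, Finset.sum_add_distrib, ← Finset.mul_sum,
      ← Finset.sum_mul, h5, h6, ← hs]
    ring
  intro x y z w
  have hn3 : (3 : ℝ) ≤ n := by exact_mod_cast hn
  have hn2 : (n : ℝ) - 2 ≠ 0 := by linarith
  have hn1 : (n : ℝ) - 1 ≠ 0 := by linarith
  have hpsi : psi1 (ricci e (fun a b c d => K a b c d)) x y z w
      + psi2 P (ricci e (fun a b c d => K a b c d)) x y z w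
      = psi1 (ricci e (fun a b c d => R' a b c d)) x y z w
      + psi2 P (ricci e (fun a b c d => R' a b c d)) x y z w
      - (2 * t * (pi1 x y z w + pi2 P x y z w) + 2 * s * pi3 P x y z w
        + 2 * ((n : ℝ) - 2) * (psi1 (fun a b => S a b) x y z w
          + psi2 P (fun a b => S a b) x y z w)) := by
    simp only [psi1, psi2, pi1, pi2, pi3, hric, hP2]
    ring
  simp only [bochner]
  rw [hpsi, htau, htauS, hKR]
  field_simp
  ring
end
end

section
/- Let S be a bilinear form on V with S(y,z) = S(z,y) and S(y,Pz) = S(z,Py) for all y,z, and set S̃(y,z) = S(y,Pz), tr S = Σᵢ S(eᵢ,eᵢ), tr S̃ = Σᵢ S̃(eᵢ,eᵢ). Then ρ((ψ₁+ψ₂)(S)) = (tr S)·g + (tr S̃)·g̃ + 2(n−2)·S, τ((ψ₁+ψ₂)(S)) = 4(n−1)·tr S, and τ*((ψ₁+ψ₂)(S)) = 4(n−1)·tr S̃. (Equalities (19)–(20) in the proof of Theorem 3.1.) -/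
open scoped InnerProductSpace

noncomputable section

variable {V : Type*} [NormedAddCommGroup V] [InnerProductSpace ℝ V]

/-- equalities (19)–(20) in the proof of Theorem 3.1.
For a symmetric bilinear form `S` with `S(y,Pz) = S(z,Py)`:
`ρ((ψ₁+ψ₂)(S)) = (tr S)·g + (tr S̃)·g̃ + 2(n−2)·S`,
`τ((ψ₁+ψ₂)(S)) = 4(n−1)·tr S` and `τ*((ψ₁+ψ₂)(S)) = 4(n−1)·tr S̃`. -/
theorem stmt_2
    [FiniteDimensional ℝ V] (n : ℕ) (hn : 1 ≤ n)
    (hdim : Module.finrank ℝ V = 2 * n)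
    (P : V →ₗ[ℝ] V) (hP2 : ∀ x : V, P (P x) = x)
    (hPg : ∀ x y : V, ⟪P x, P y⟫_ℝ = ⟪x, y⟫_ℝ)
    (hPtr : LinearMap.trace ℝ V P = 0)
    (e : OrthonormalBasis (Fin (2 * n)) ℝ V)
    (S : V →ₗ[ℝ] V →ₗ[ℝ] ℝ)
    (hSsym : ∀ y z : V, S y z = S z y)
    (hSP : ∀ y z : V, S y (P z) = S z (P y)) :
    (∀ y z : V,
      ricci e (fun a b c d => psi1 (fun u v => S u v) a b c d
        + psi2 P (fun u v => S u v) a b c d) y z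
        = (∑ i, S (e i) (e i)) * ⟪y, z⟫_ℝ + (∑ i, S (e i) (P (e i))) * ⟪y, P z⟫_ℝ
          + 2 * ((n : ℝ) - 2) * S y z) ∧
    tau e (fun a b c d => psi1 (fun u v => S u v) a b c d
        + psi2 P (fun u v => S u v) a b c d)
      = 4 * ((n : ℝ) - 1) * (∑ i, S (e i) (e i)) ∧
    tauStar e P (fun a b c d => psi1 (fun u v => S u v) a b c d
        + psi2 P (fun u v => S u v) a b c d)
      = 4 * ((n : ℝ) - 1) * (∑ i, S (e i) (P (e i))) := by
  have hPs : ∀ x y : V, ⟪x, P y⟫_ℝ = ⟪P x, y⟫_ℝ := by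
    intro x y
    rw [← hPg x (P y), hP2]
  have hSS : ∀ y z : V, S (P y) (P z) = S y z := by
    intro y z
    rw [hSP, hP2, hSsym]
  have htr : ∑ i, ⟪e i, P (e i)⟫_ℝ = 0 := by
    rw [← LinearMap.trace_eq_sum_inner P e, hPtr]
  have hone : ∀ i, ⟪e i, e i⟫_ℝ = 1 := by
    intro i
    rw [real_inner_self_eq_norm_sq, e.norm_eq_one]
    norm_num
  have hexp : ∀ (f : V →ₗ[ℝ] ℝ) (z : V), ∑ i, ⟪e i, z⟫_ℝ * f (e i) = f z := by
    intro f z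
    conv_rhs => rw [← e.sum_repr' z]
    simp [map_sum]
  have hric : ∀ y z : V,
      ricci e (fun a b c d => psi1 (fun u v => S u v) a b c d
        + psi2 P (fun u v => S u v) a b c d) y z
        = (∑ i, S (e i) (e i)) * ⟪y, z⟫_ℝ + (∑ i, S (e i) (P (e i))) * ⟪y, P z⟫_ℝ
          + 2 * ((n : ℝ) - 2) * S y z := by
    intro y z
    have h1 := hexp (S y) z
    have h2 := hexp (S z) y
    have h3 := hexp (S y ∘ₗ P) (P z)
    have h4 := hexp (S (P z)) (P y)
    simp only [LinearMap.comp_apply, hP2, hSS] at h3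
    rw [hSS, hSsym] at h4
    rw [hSsym z y] at h2
    have key : ∀ i, psi1 (fun u v => S u v) (e i) y z (e i)
        + psi2 P (fun u v => S u v) (e i) y z (e i)
        = S (e i) (e i) * ⟪y, z⟫_ℝ + S (e i) (P (e i)) * ⟪y, P z⟫_ℝ + S y z
          + ⟪e i, P (e i)⟫_ℝ * S y (P z)
          - ⟪e i, z⟫_ℝ * S y (e i) - ⟪e i, y⟫_ℝ * S z (e i)
          - ⟪e i, P z⟫_ℝ * S y (P (e i)) - ⟪e i, P y⟫_ℝ * S (P z) (e i) := by
      intro i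
      simp only [psi1, psi2]
      rw [hone, hSsym (e i) z, hSsym (e i) (P z), hPs y (e i),
        real_inner_comm (e i) y, real_inner_comm (e i) (P y)]
      ring
    simp only [ricci]
    rw [Finset.sum_congr rfl (fun i _ => key i)]
    simp only [Finset.sum_add_distrib, Finset.sum_sub_distrib, ← Finset.sum_mul]
    rw [h1, h2, h3, h4, htr]
    simp
    ring
  refine ⟨hric, ?_, ?_⟩
  · simp only [tau, hric, hone]
    simp only [Finset.sum_add_distrib, ← Finset.mul_sum]
    rw [htr]
    simp
    ring
  · have hst : ∀ y z : V,
      ricciStar e P (fun a b c d => psi1 (fun u v => S u v) a b c d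
        + psi2 P (fun u v => S u v) a b c d) y z
      = ricci e (fun a b c d => psi1 (fun u v => S u v) a b c d
        + psi2 P (fun u v => S u v) a b c d) y (P z) := by
      intro y z
      simp only [ricciStar, ricci, psi2, hP2]
      exact Finset.sum_congr rfl (fun i _ => add_comm _ _)
    simp only [tauStar, hst, hric, hone, hP2]
    simp only [Finset.sum_add_distrib, ← Finset.mul_sum]
    rw [htr]
    simp
    ring
end
end

section
/- Let n ≥ 2, let ε ∈ {1,−1}, and let R' be a Riemannian P-tensor on V. Then the following are equivalent: (i) for all linearly independent x,y ∈ V spanning a totally real 2-plane, ν'(x,y) = τ(R')/(4n(n−1)) and ν'*(x,y) = −ε·τ(R')/(4n(n−1)); (ii) A(R') = 0. (Pointwise algebraic form of Theorem 4.2 for the curvature tensor of the canonical connection.) -/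
open scoped InnerProductSpace

noncomputable section

variable {V : Type*} [NormedAddCommGroup V] [InnerProductSpace ℝ V]

theorem pair_symm_aux {L : V → V → V → V → ℝ} (h : CurvatureLike L) (x y z w : V) :
    L x y z w = L z w x y := by
  obtain ⟨h1, h2, h3⟩ := h
  have b1 := h3 x y z w
  have b2 := h3 y z w x
  have b3 := h3 z w x y
  have b4 := h3 w x y z
  have := h1 x y z w
  have := h2 x y z w
  have := h2 y z x w
  have := h2 z x y w
  have := h2 z w x y
  have := h2 y x z w
  have := h1 z w x y
  have := h1 x w y z
  have := h2 w x y z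
  have := h2 x w y z
  have := h2 w x z y
  have := h1 w z x y
  have := h1 w z y x
  have := h2 w z y x
  have := h1 w y z x
  have := h2 w y z x
  have := h2 y w z x
  have := h1 w x y z
  have := h1 x z w y
  have := h2 x z w y
  have := h2 z x w y
  have := h1 y w x z
  have := h2 y w x z
  have := h1 z x y w
  linarith

theorem polar_aux {L : V → V → V → V → ℝ} (h : CurvatureLike L)
    (a1 : ∀ x x' y z w, L (x + x') y z w = L x y z w + L x' y z w)
    (a2 : ∀ x y y' z w, L x (y + y') z w = L x y z w + L x y' z w)
    (a3 : ∀ x y z z' w, L x y (z + z') w = L x y z w + L x y z' w)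
    (a4 : ∀ x y z w w', L x y z (w + w') = L x y z w + L x y z w')
    (h0 : ∀ x y, L x y y x = 0) (x y z w : V) : L x y z w = 0 := by
  have ps := pair_symm_aux h
  obtain ⟨h1, h2, h3⟩ := h
  have k1 : ∀ x y w, L x y y w = 0 := by
    intro x y w
    have e := h0 (x + w) y
    rw [a1, a4, a4, h0, h0] at e
    have := ps w y y x
    have := h1 y x w y
    have := h2 x y w y
    linarith
  have k2 : ∀ x y z w, L x y z w = - L x z y w := by
    intro x y z w
    have e := k1 x (y + z) w
    rw [a2, a3, a3, k1, k1] at e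
    linarith
  have b := h3 x y z w
  have := k2 x y z w
  have := k2 y z x w
  have := h1 x z y w
  have := h1 y x z w
  linarith

theorem indep_of_pi1 {x y : V} (h : pi1 x y y x ≠ 0) : LinearIndependent ℝ ![x, y] := by
  rw [LinearIndependent.pair_iff]
  intro s t hst
  have e1 : s * ⟪x, x⟫_ℝ + t * ⟪x, y⟫_ℝ = 0 := by
    have := congrArg (fun v => ⟪x, v⟫_ℝ) hst
    simpa [inner_add_right, inner_smul_right] using this
  have e2 : s * ⟪x, y⟫_ℝ + t * ⟪y, y⟫_ℝ = 0 := by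
    have := congrArg (fun v => ⟪y, v⟫_ℝ) hst
    simpa [inner_add_right, inner_smul_right, real_inner_comm] using this
  simp only [pi1, psi1, real_inner_comm x y] at h
  constructor
  · refine (mul_eq_zero.1 (?_ : s * _ = 0)).resolve_right h
    linear_combination ⟪y, y⟫_ℝ * e1 - ⟪x, y⟫_ℝ * e2
  · refine (mul_eq_zero.1 (?_ : t * _ = 0)).resolve_right h
    linear_combination ⟪x, x⟫_ℝ * e2 - ⟪x, y⟫_ℝ * e1

theorem dep_of_pi1 {x y : V} (h : pi1 x y y x = 0) : y = 0 ∨ ∃ k : ℝ, x = k • y := by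
  by_cases hy : y = 0
  · exact Or.inl hy
  right
  have hyy : ⟪y, y⟫_ℝ ≠ 0 := by simpa using hy
  have hz : ⟪y, y⟫_ℝ • x - ⟪x, y⟫_ℝ • y = 0 := by
    rw [← inner_self_eq_zero (𝕜 := ℝ)]
    simp only [inner_sub_left, inner_sub_right, inner_smul_left, inner_smul_right, RCLike.conj_to_real]
    simp only [pi1, psi1, real_inner_comm x y] at h ⊢
    linear_combination ⟪y, y⟫_ℝ * h
  refine ⟨⟪x, y⟫_ℝ / ⟪y, y⟫_ℝ, ?_⟩
  rw [div_eq_inv_mul, mul_smul, ← sub_eq_zero.1 hz, smul_smul, inv_mul_cancel₀ hyy, one_smul]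

theorem pi1_ne_of_indep {x y : V} (h : LinearIndependent ℝ ![x, y]) : pi1 x y y x ≠ 0 := by
  intro h0
  rw [LinearIndependent.pair_iff] at h
  rcases dep_of_pi1 h0 with hy | ⟨k, hk⟩
  · have := h 0 1 (by simp [hy])
    simp at this
  · have := h 1 (-k) (by simp [hk])
    simp at this

theorem eigen_isometry [FiniteDimensional ℝ V] (n : ℕ)
    (hdim : Module.finrank ℝ V = 2 * n)
    (P : V →ₗ[ℝ] V) (hP2 : ∀ x : V, P (P x) = x)
    (hPtr : LinearMap.trace ℝ V P = 0) :
    Nonempty (LinearMap.ker (P - 1) ≃ₗᵢ[ℝ] LinearMap.ker (P + 1)) := by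
  have p1 : LinearMap.IsProj (LinearMap.ker (P - 1)) ((1/2 : ℝ) • (1 + P)) := by
    constructor
    · intro x
      simp [hP2, sub_eq_zero, add_comm]
    · intro x hx
      have : P x = x := by simpa [sub_eq_zero] using hx
      simp only [LinearMap.smul_apply, LinearMap.add_apply, Module.End.one_apply, this]
      module
  have p2 : LinearMap.IsProj (LinearMap.ker (P + 1)) ((1/2 : ℝ) • (1 - P)) := by
    constructor
    · intro x
      simp [hP2, ← smul_add]
    · intro x hx
      have : P x = -x := by simpa [add_eq_zero_iff_eq_neg] using hx
      simp [this, ← two_smul ℝ x, smul_smul]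
  have t1 := p1.trace
  have t2 := p2.trace
  have hr : Module.finrank ℝ (LinearMap.ker (P - 1)) = Module.finrank ℝ (LinearMap.ker (P + 1)) := by
    have : (Module.finrank ℝ (LinearMap.ker (P - 1)) : ℝ) = Module.finrank ℝ (LinearMap.ker (P + 1)) := by
      rw [← t1, ← t2]; simp [hPtr]
    exact_mod_cast this
  exact ⟨(stdOrthonormalBasis ℝ _).equiv (stdOrthonormalBasis ℝ _) (finCongr hr)⟩

theorem split_aux (P : V →ₗ[ℝ] V) (R : V →ₗ[ℝ] V →ₗ[ℝ] V →ₗ[ℝ] V →ₗ[ℝ] ℝ)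
    (hR : IsRiemannianPTensor P (fun x y z w => R x y z w)) {a b c d : V}
    (ha : P a = a) (hc : P c = c) (hb : P b = -b) (hd : P d = -d) :
    R (a + b) (c + d) (c + d) (a + b) = R a c c a + R b d d b ∧
    R (a + b) (c + d) (c + d) (a - b) = R a c c a - R b d d b := by
  have ps := pair_symm_aux hR.1
  obtain ⟨⟨h1, h2, h3⟩, hP⟩ := hR
  simp only at ps h1 h2 h3 hP
  have m1 : ∀ {u v : V}, P u = u → P v = -v → ∀ x y, R x y u v = 0 := by
    intro u v hu hv x y
    have := hP x y u v
    rw [hu, hv, map_neg] at this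
    linarith
  have m2 : ∀ {u v : V}, P u = u → P v = -v → ∀ x y, R x y v u = 0 := by
    intro u v hu hv x y
    rw [h2, m1 hu hv, neg_zero]
  have m3 : ∀ {u v : V}, P u = u → P v = -v → ∀ x y, R u v x y = 0 := by
    intro u v hu hv x y
    rw [ps, m1 hu hv]
  have m4 : ∀ {u v : V}, P u = u → P v = -v → ∀ x y, R v u x y = 0 := by
    intro u v hu hv x y
    rw [ps, m2 hu hv]
  have q1 : R a c d b = 0 := by
    have := h3 a c d b
    rw [m3 hc hd, m4 ha hd] at this
    linarith
  have q2 : R b d c a = 0 := by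
    have := h3 b d c a
    rw [m4 hc hd, m3 hc hb] at this
    linarith
  simp [m1 hc hb, m2 ha hd, m3 ha hd, m4 hc hb, q1, q2, sub_eq_add_neg]

/-- pointwise algebraic form of Theorem 4.2.
A Riemannian P-tensor `R'` has the point-wise constant totally real sectional curvatures
`ν' = τ'/(4n(n−1))` and `ν'* = −ε·τ'/(4n(n−1))` iff `A(R') = 0`. -/
theorem stmt_6
    [FiniteDimensional ℝ V] (n : ℕ) (hn : 2 ≤ n)
    (hdim : Module.finrank ℝ V = 2 * n)
    (P : V →ₗ[ℝ] V) (hP2 : ∀ x : V, P (P x) = x)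
    (hPg : ∀ x y : V, ⟪P x, P y⟫_ℝ = ⟪x, y⟫_ℝ)
    (hPtr : LinearMap.trace ℝ V P = 0)
    (e : OrthonormalBasis (Fin (2 * n)) ℝ V)
    (ε : ℝ) (hε : ε = 1 ∨ ε = -1)
    (R' : V →ₗ[ℝ] V →ₗ[ℝ] V →ₗ[ℝ] V →ₗ[ℝ] ℝ)
    (hR' : IsRiemannianPTensor P (fun x y z w => R' x y z w)) :
    (∀ x y : V, LinearIndependent ℝ ![x, y] → TotallyReal P x y →
        R' x y y x / pi1 x y y x
          = tau e (fun a b c d => R' a b c d) / (4 * (n : ℝ) * ((n : ℝ) - 1)) ∧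
        R' x y y (P x) / pi1 x y y x
          = - ε * tau e (fun a b c d => R' a b c d) / (4 * (n : ℝ) * ((n : ℝ) - 1)))
      ↔ (∀ x y z w : V, Atens n ε e P (fun a b c d => R' a b c d) x y z w = 0) := by
  set k : ℝ := tau e (fun a b c d => R' a b c d) / (4 * (n : ℝ) * ((n : ℝ) - 1)) with hk
  have hk2 : - ε * tau e (fun a b c d => R' a b c d) / (4 * (n : ℝ) * ((n : ℝ) - 1)) = -ε * k := by
    rw [hk]; ring
  rw [hk2]
  have hPs : ∀ x y : V, ⟪P x, y⟫_ℝ = ⟪x, P y⟫_ℝ := by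
    intro x y
    rw [← hPg x (P y), hP2]
  constructor
  · intro H
    obtain ⟨J⟩ := eigen_isometry n hdim P hP2 hPtr
    -- the key computation
    have key : ∀ a b c d : V, P a = a → P c = c → P b = -b → P d = -d →
        ⟪a, a⟫_ℝ = ⟪b, b⟫_ℝ → ⟪a, c⟫_ℝ = ⟪b, d⟫_ℝ → ⟪c, c⟫_ℝ = ⟪d, d⟫_ℝ → pi1 a c c a ≠ 0 →
        R' a c c a = 2 * (1 - ε) * k * pi1 a c c a ∧
        R' b d d b = 2 * (1 + ε) * k * pi1 b d d b := by
      intro a b c d ha hc hb hd e1 e2 e3 hne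
      have orth : ∀ {u v : V}, P u = u → P v = -v → ⟪u, v⟫_ℝ = 0 := by
        intro u v hu hv
        have := hPg u v
        rw [hu, hv, inner_neg_right] at this
        linarith
      have o1 := orth ha hb
      have o2 := orth ha hd
      have o3 := orth hc hb
      have o4 := orth hc hd
      have o1' : ⟪b, a⟫_ℝ = 0 := by rw [real_inner_comm]; exact o1
      have o2' : ⟪d, a⟫_ℝ = 0 := by rw [real_inner_comm]; exact o2
      have o3' : ⟪b, c⟫_ℝ = 0 := by rw [real_inner_comm]; exact o3
      have o4' : ⟪d, c⟫_ℝ = 0 := by rw [real_inner_comm]; exact o4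
      have e2' : ⟪c, a⟫_ℝ = ⟪d, b⟫_ℝ := by
        rw [real_inner_comm, e2, real_inner_comm]
      have p0 : pi1 b d d b = pi1 a c c a := by
        simp only [pi1, psi1, e1, e2, e3, e2']
      have p1 : pi1 (a + b) (c + d) (c + d) (a + b) = 4 * pi1 a c c a := by
        simp only [pi1, psi1, inner_add_left, inner_add_right, e1, e2, e3, e2', o1, o2, o3, o4,
          o1', o2', o3', o4']
        ring
      have hne' : pi1 (a + b) (c + d) (c + d) (a + b) ≠ 0 := by
        rw [p1]; positivity
      have tr : TotallyReal P (a + b) (c + d) := by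
        refine ⟨?_, ?_, ?_, ?_⟩ <;>
        simp only [map_add, inner_add_left, inner_add_right, inner_neg_right, e1, e2, e3, e2',
          o1, o2, o3, o4, o1', o2', o3', o4', ha, hb, hc, hd] <;> ring
      obtain ⟨H1, H2⟩ := H _ _ (indep_of_pi1 hne') tr
      rw [div_eq_iff hne'] at H1 H2
      obtain ⟨s1, s2⟩ := split_aux P R' hR' ha hc hb hd
      have hPx : P (a + b) = a - b := by rw [map_add, ha, hb, sub_eq_add_neg]
      rw [hPx, s2, p1] at H2
      rw [s1, p1] at H1
      rw [p0]
      constructor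
      · linear_combination (H1 + H2) / 2
      · linear_combination (H1 - H2) / 2
    have deg : ∀ a c : V, pi1 a c c a = 0 → R' a c c a = 0 := by
      intro a c h
      rcases dep_of_pi1 h with h | ⟨t, h⟩
      · simp [h]
      · have := hR'.1.1 c c c c
        simp only at this
        have h0 : R' c c c c = 0 := by linarith
        simp [h, h0]
    have kp : ∀ a c : V, P a = a → P c = c → R' a c c a = 2 * (1 - ε) * k * pi1 a c c a := by
      intro a c ha hc
      by_cases h : pi1 a c c a = 0
      · rw [deg a c h, h, mul_zero]
      let a' : LinearMap.ker (P - 1) := ⟨a, by simp [ha]⟩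
      let c' : LinearMap.ker (P - 1) := ⟨c, by simp [hc]⟩
      have hm : ∀ v : LinearMap.ker (P + 1), P v = -(v : V) := by
        intro v
        have := LinearMap.mem_ker.1 v.2
        simpa only [LinearMap.add_apply, Module.End.one_apply, add_eq_zero_iff_eq_neg] using this
      exact (key a (J a') c (J c') ha hc (hm _) (hm _) (J.inner_map_map a' a').symm
        (J.inner_map_map a' c').symm (J.inner_map_map c' c').symm h).1
    have km : ∀ b d : V, P b = -b → P d = -d → R' b d d b = 2 * (1 + ε) * k * pi1 b d d b := by
      intro b d hb hd
      by_cases h : pi1 b d d b = 0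
      · rw [deg b d h, h, mul_zero]
      let b' : LinearMap.ker (P + 1) := ⟨b, by simp [hb]⟩
      let d' : LinearMap.ker (P + 1) := ⟨d, by simp [hd]⟩
      have hm : ∀ v : LinearMap.ker (P - 1), P v = (v : V) := by
        intro v
        have := LinearMap.mem_ker.1 v.2
        simpa only [LinearMap.sub_apply, Module.End.one_apply, sub_eq_zero] using this
      have i1 : ⟪(J.symm b' : V), (J.symm b' : V)⟫_ℝ = ⟪b, b⟫_ℝ := J.symm.inner_map_map b' b'
      have i2 : ⟪(J.symm b' : V), (J.symm d' : V)⟫_ℝ = ⟪b, d⟫_ℝ := J.symm.inner_map_map b' d'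
      have i3 : ⟪(J.symm d' : V), (J.symm d' : V)⟫_ℝ = ⟪d, d⟫_ℝ := J.symm.inner_map_map d' d'
      have i4 : ⟪(J.symm d' : V), (J.symm b' : V)⟫_ℝ = ⟪d, b⟫_ℝ := J.symm.inner_map_map d' b'
      refine (key (J.symm b') b (J.symm d') d (hm _) (hm _) hb hd i1 i2 i3 ?_).2
      simpa only [pi1, psi1, i1, i2, i3, i4] using h
    apply polar_aux
    · obtain ⟨⟨h1, h2, h3⟩, -⟩ := hR'
      simp only at h1 h2 h3
      refine ⟨?_, ?_, ?_⟩
      · intro x y z w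
        simp only [Atens, ← hk, pi1, pi2, pi3, psi2, psi1]
        rw [h1]; ring
      · intro x y z w
        simp only [Atens, ← hk, pi1, pi2, pi3, psi2, psi1]
        rw [h2]; ring
      · intro x y z w
        have := h3 x y z w
        simp only [Atens, ← hk, pi1, pi2, pi3, psi2, psi1]
        rw [real_inner_comm x y, real_inner_comm x z, real_inner_comm y z,
          ← hPs z x, ← hPs z y, ← hPs y x, real_inner_comm x (P z), real_inner_comm y (P z),
          real_inner_comm x (P y)]
        linear_combination this
    · intro x x' y z w
      simp only [Atens, ← hk, pi1, pi2, pi3, psi2, psi1, inner_add_left, map_add,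
        LinearMap.add_apply]
      ring
    · intro x y y' z w
      simp only [Atens, ← hk, pi1, pi2, pi3, psi2, psi1, inner_add_left, map_add,
        LinearMap.add_apply]
      ring
    · intro x y z z' w
      simp only [Atens, ← hk, pi1, pi2, pi3, psi2, psi1, inner_add_right, map_add,
        LinearMap.add_apply]
      ring
    · intro x y z w w'
      simp only [Atens, ← hk, pi1, pi2, pi3, psi2, psi1, inner_add_right, map_add]
      ring
    · intro x y
      have dec : ∀ x : V, ∃ a b : V, P a = a ∧ P b = -b ∧ x = a + b := by
        intro x
        refine ⟨(1/2 : ℝ) • (x + P x), (1/2 : ℝ) • (x - P x), ?_, ?_, ?_⟩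
        · simp [hP2, add_comm]
        · simp [hP2, ← smul_neg]
        · module
      obtain ⟨a, b, ha, hb, rfl⟩ := dec x
      obtain ⟨c, d, hc, hd, rfl⟩ := dec y
      have orth : ∀ {u v : V}, P u = u → P v = -v → ⟪u, v⟫_ℝ = 0 := by
        intro u v hu hv
        have := hPg u v
        rw [hu, hv, inner_neg_right] at this
        linarith
      have o1 := orth ha hb
      have o2 := orth ha hd
      have o3 := orth hc hb
      have o4 := orth hc hd
      have o1' : ⟪b, a⟫_ℝ = 0 := by rw [real_inner_comm]; exact o1
      have o2' : ⟪d, a⟫_ℝ = 0 := by rw [real_inner_comm]; exact o2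
      have o3' : ⟪b, c⟫_ℝ = 0 := by rw [real_inner_comm]; exact o3
      have o4' : ⟪d, c⟫_ℝ = 0 := by rw [real_inner_comm]; exact o4
      simp only [Atens, ← hk]
      rw [(split_aux P R' hR' ha hc hb hd).1, kp a c ha hc, km b d hb hd]
      simp only [pi1, pi2, pi3, psi2, psi1, map_add, ha, hb, hc, hd, inner_add_left,
        inner_add_right, inner_neg_right, o1, o2, o3, o4, o1', o2', o3', o4']
      ring
  · intro H x y hxy htr
    have hne := pi1_ne_of_indep hxy
    obtain ⟨t1, t2, t3, t4⟩ := htr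
    have A1 := H x y y x
    have A2 := H x y y (P x)
    simp only [Atens, ← hk] at A1 A2
    rw [div_eq_iff hne, div_eq_iff hne]
    constructor
    · simp only [pi1, pi2, pi3, psi2, psi1, t1, t2, t3, t4] at A1 ⊢
      linear_combination A1
    · simp only [pi1, pi2, pi3, psi2, psi1, t1, t2, t3, t4, hP2] at A2 ⊢
      linear_combination A2
end
end

section
/- Let n ≥ 2, let a, b ∈ ℝ, and let K and R' be (0,4)-tensors on V satisfying K = R' − a·(π₁+π₂) − b·π₃. Then C(R') = C(K). (Pointwise algebraic form of Theorem 5.1: for a natural connection with parallel torsion on a manifold of class W̄₃ ∪ W̄₆ with closed 1-form θ, one has K = R' − ((g(p,p)+g(q,q))/2)(π₁+π₂) − g(p,q)π₃, and hence C(R') = C(K).) -/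
open scoped InnerProductSpace

noncomputable section

variable {V : Type*} [NormedAddCommGroup V] [InnerProductSpace ℝ V]

section Helpers

variable {m : ℕ} (e : OrthonormalBasis (Fin m) ℝ V) (P : V →ₗ[ℝ] V)

theorem P_symm (hP2 : ∀ x : V, P (P x) = x) (hPg : ∀ x y : V, ⟪P x, P y⟫_ℝ = ⟪x, y⟫_ℝ)
    (x y : V) : ⟪x, P y⟫_ℝ = ⟪y, P x⟫_ℝ := by
  rw [← hPg x (P y), hP2, real_inner_comm]

theorem trace_sum (hPtr : LinearMap.trace ℝ V P = 0) : ∑ i, ⟪e i, P (e i)⟫_ℝ = 0 := by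
  rw [← LinearMap.trace_eq_sum_inner P e, hPtr]

theorem sum_delta (f : Fin m → Fin m → ℝ) :
    ∑ j, ∑ i, ⟪e i, e j⟫_ℝ * f i j = ∑ j, f j j := by
  simp [e.inner_eq_ite]

theorem sum_sq (hP2 : ∀ x : V, P (P x) = x) (hPg : ∀ x y : V, ⟪P x, P y⟫_ℝ = ⟪x, y⟫_ℝ) :
    ∑ j, ∑ i, ⟪e i, P (e j)⟫_ℝ * ⟪e i, P (e j)⟫_ℝ = m := by
  have h : ∀ j, ∑ i, ⟪e i, P (e j)⟫_ℝ * ⟪e i, P (e j)⟫_ℝ = 1 := by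
    intro j
    have := e.sum_inner_mul_inner (P (e j)) (P (e j))
    rw [hPg, e.inner_eq_one] at this
    rw [← this]
    exact Finset.sum_congr rfl fun i _ => by rw [real_inner_comm (e i) (P (e j))]
  simp [h]

theorem sum_prod (f h : Fin m → ℝ) :
    ∑ j, ∑ i, f j * h i = (∑ j, f j) * ∑ i, h i := by
  rw [Finset.sum_mul_sum]

theorem tau_aux (hP2 : ∀ x : V, P (P x) = x) (hPg : ∀ x y : V, ⟪P x, P y⟫_ℝ = ⟪x, y⟫_ℝ)
    (hPtr : LinearMap.trace ℝ V P = 0) (a b : ℝ) :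
    ∑ j, ∑ i, (a * (pi1 (e i) (e j) (e j) (e i) + pi2 P (e i) (e j) (e j) (e i))
      + b * pi3 P (e i) (e j) (e j) (e i)) = a * (m * m - 2 * m) := by
  have key : ∀ j i, (a * (pi1 (e i) (e j) (e j) (e i) + pi2 P (e i) (e j) (e j) (e i))
      + b * pi3 P (e i) (e j) (e j) (e i))
      = a * (1 * 1) - ⟪e i, e j⟫_ℝ * (a * ⟪e i, e j⟫_ℝ)
        + a * (⟪e j, P (e j)⟫_ℝ * ⟪e i, P (e i)⟫_ℝ)
        - a * (⟪e i, P (e j)⟫_ℝ * ⟪e i, P (e j)⟫_ℝ)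
        + b * (1 * ⟪e i, P (e i)⟫_ℝ) + b * (⟪e j, P (e j)⟫_ℝ * 1)
        - ⟪e i, e j⟫_ℝ * (2 * b * ⟪e i, P (e j)⟫_ℝ) := by
    intro j i
    simp only [pi1, pi2, pi3, psi2, psi1, e.inner_eq_one, real_inner_comm (e i) (e j),
      P_symm P hP2 hPg (e j) (e i)]
    ring
  simp only [key, Finset.sum_add_distrib, Finset.sum_sub_distrib, sum_delta]
  simp only [← Finset.mul_sum, sum_sq e P hP2 hPg, trace_sum e P hPtr, e.inner_eq_one]
  simp [trace_sum e P hPtr, ← Finset.sum_mul]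
  ring

theorem tauStar_aux (hP2 : ∀ x : V, P (P x) = x)
    (hPg : ∀ x y : V, ⟪P x, P y⟫_ℝ = ⟪x, y⟫_ℝ)
    (hPtr : LinearMap.trace ℝ V P = 0) (a b : ℝ) :
    ∑ j, ∑ i, (a * (pi1 (e i) (e j) (e j) (P (e i)) + pi2 P (e i) (e j) (e j) (P (e i)))
      + b * pi3 P (e i) (e j) (e j) (P (e i))) = b * (m * m - 2 * m) := by
  have key : ∀ j i, (a * (pi1 (e i) (e j) (e j) (P (e i)) + pi2 P (e i) (e j) (e j) (P (e i)))
      + b * pi3 P (e i) (e j) (e j) (P (e i)))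
      = b * (1 * 1) - ⟪e i, e j⟫_ℝ * (b * ⟪e i, e j⟫_ℝ)
        + b * (⟪e j, P (e j)⟫_ℝ * ⟪e i, P (e i)⟫_ℝ)
        - b * (⟪e i, P (e j)⟫_ℝ * ⟪e i, P (e j)⟫_ℝ)
        + a * (1 * ⟪e i, P (e i)⟫_ℝ) + a * (⟪e j, P (e j)⟫_ℝ * 1)
        - ⟪e i, e j⟫_ℝ * (2 * a * ⟪e i, P (e j)⟫_ℝ) := by
    intro j i
    simp only [pi1, pi2, pi3, psi2, psi1, hP2, e.inner_eq_one, real_inner_comm (e i) (e j),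
      P_symm P hP2 hPg (e j) (e i)]
    ring
  simp only [key, Finset.sum_add_distrib, Finset.sum_sub_distrib, sum_delta]
  simp only [← Finset.mul_sum, sum_sq e P hP2 hPg, trace_sum e P hPtr, e.inner_eq_one]
  simp [trace_sum e P hPtr, ← Finset.sum_mul]
  ring

end Helpers

/-- pointwise algebraic form of Theorem 5.1.
If `K = R' − a·(π₁+π₂) − b·π₃` for some `a, b ∈ ℝ` (n ≥ 2), then `C(R') = C(K)`. -/
theorem stmt_7
    [FiniteDimensional ℝ V] (n : ℕ) (hn : 2 ≤ n)
    (hdim : Module.finrank ℝ V = 2 * n)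
    (P : V →ₗ[ℝ] V) (hP2 : ∀ x : V, P (P x) = x)
    (hPg : ∀ x y : V, ⟪P x, P y⟫_ℝ = ⟪x, y⟫_ℝ)
    (hPtr : LinearMap.trace ℝ V P = 0)
    (e : OrthonormalBasis (Fin (2 * n)) ℝ V)
    (a b : ℝ)
    (K R' : V →ₗ[ℝ] V →ₗ[ℝ] V →ₗ[ℝ] V →ₗ[ℝ] ℝ)
    (hKR : ∀ x y z w : V, K x y z w = R' x y z w
        - a * (pi1 x y z w + pi2 P x y z w) - b * pi3 P x y z w) :
    ∀ x y z w : V,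
      Ctens n e P (fun a' b' c' d' => R' a' b' c' d') x y z w
        = Ctens n e P (fun a' b' c' d' => K a' b' c' d') x y z w := by
  intro x y z w
  have h1 : tau e (fun a' b' c' d' => K a' b' c' d')
      = tau e (fun a' b' c' d' => R' a' b' c' d') - a * (4 * n * (n - 1)) := by
    have h := tau_aux e P hP2 hPg hPtr a b
    push_cast at h
    rw [show a * (4 * (n : ℝ) * (n - 1)) = a * (2 * n * (2 * n) - 2 * (2 * n)) by ring, ← h]
    simp only [tau, ricci, hKR, ← Finset.sum_sub_distrib, sub_sub]
  have h2 : tauStar e P (fun a' b' c' d' => K a' b' c' d')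
      = tauStar e P (fun a' b' c' d' => R' a' b' c' d') - b * (4 * n * (n - 1)) := by
    have h := tauStar_aux e P hP2 hPg hPtr a b
    push_cast at h
    rw [show b * (4 * (n : ℝ) * (n - 1)) = b * (2 * n * (2 * n) - 2 * (2 * n)) by ring, ← h]
    simp only [tauStar, ricciStar, hKR, ← Finset.sum_sub_distrib, sub_sub]
  have hn' : (2 : ℝ) ≤ n := by exact_mod_cast hn
  have hn0 : (n : ℝ) ≠ 0 := by linarith
  have hn1 : (n : ℝ) - 1 ≠ 0 := by linarith
  simp only [Ctens]
  rw [h1, h2, hKR]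
  field_simp
  ring
end
end

section
/- Let n ≥ 2 and let R' be a Riemannian P-tensor on V. Then the following are equivalent: (i) for all linearly independent x,y ∈ V spanning a totally real 2-plane, ν'(x,y) = τ(R')/(4n(n−1)) and ν'*(x,y) = τ*(R')/(4n(n−1)); (ii) C(R') = 0. (Pointwise algebraic form of Theorem 5.2 for the curvature tensor of a natural connection with parallel torsion.) -/
open scoped InnerProductSpace

noncomputable section

variable {V : Type*} [NormedAddCommGroup V] [InnerProductSpace ℝ V]

theorem aux_finrank [FiniteDimensional ℝ V] (n : ℕ)
    (hdim : Module.finrank ℝ V = 2 * n)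
    (P : V →ₗ[ℝ] V) (hP2 : ∀ x : V, P (P x) = x)
    (hPtr : LinearMap.trace ℝ V P = 0) :
    Module.finrank ℝ (LinearMap.ker (P - LinearMap.id)) = n := by
  have h : LinearMap.IsProj (LinearMap.ker (P - LinearMap.id))
      ((1 / 2 : ℝ) • (LinearMap.id + P)) := by
    refine ⟨fun x => ?_, fun x hx => ?_⟩
    · simp [LinearMap.mem_ker, hP2, sub_eq_zero, add_comm]
    · have hx' : P x = x := by simpa [LinearMap.mem_ker, sub_eq_zero] using hx
      simp only [LinearMap.smul_apply, LinearMap.add_apply, LinearMap.id_apply, hx']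
      rw [← two_smul ℝ x, smul_smul]; norm_num
  have ht := h.trace
  rw [map_smul, map_add, hPtr, LinearMap.trace_id, hdim] at ht
  have : (n : ℝ) = (Module.finrank ℝ (LinearMap.ker (P - LinearMap.id)) : ℝ) := by
    rw [← ht]; push_cast; simp
  exact_mod_cast this.symm

theorem aux_isometry [FiniteDimensional ℝ V] (n : ℕ)
    (hdim : Module.finrank ℝ V = 2 * n)
    (P : V →ₗ[ℝ] V) (hP2 : ∀ x : V, P (P x) = x)
    (hPtr : LinearMap.trace ℝ V P = 0) (u v : V) (hu : P u = u) (hv : P v = v) :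
    ∃ u' v' : V, P u' = -u' ∧ P v' = -v' ∧ ⟪u', u'⟫_ℝ = ⟪u, u⟫_ℝ ∧
      ⟪u', v'⟫_ℝ = ⟪u, v⟫_ℝ ∧ ⟪v', v'⟫_ℝ = ⟪v, v⟫_ℝ := by
  have h1 := aux_finrank n hdim P hP2 hPtr
  have h2 := aux_finrank n hdim (-P) (by simp [hP2]) (by simp [hPtr])
  let b1 := (stdOrthonormalBasis ℝ (LinearMap.ker (P - LinearMap.id))).reindex (finCongr h1)
  let b2 := (stdOrthonormalBasis ℝ (LinearMap.ker (-P - LinearMap.id))).reindex (finCongr h2)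
  let f := b1.repr.trans b2.repr.symm
  have hu' : u ∈ LinearMap.ker (P - LinearMap.id) := by simp [hu]
  have hv' : v ∈ LinearMap.ker (P - LinearMap.id) := by simp [hv]
  have key : ∀ z : LinearMap.ker (-P - LinearMap.id), P (z : V) = -(z : V) := by
    intro z
    have := z.2
    rw [LinearMap.mem_ker] at this
    simp only [LinearMap.sub_apply, LinearMap.neg_apply, LinearMap.id_apply] at this
    rw [sub_eq_zero] at this
    exact neg_eq_iff_eq_neg.mp this
  have hi : ∀ a b, ⟪((f a : LinearMap.ker (-P - LinearMap.id)) : V), (f b : V)⟫_ℝ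
      = ⟪(a : V), (b : V)⟫_ℝ := by
    intro a b
    rw [← Submodule.coe_inner, f.inner_map_map, Submodule.coe_inner]
  exact ⟨f ⟨u, hu'⟩, f ⟨v, hv'⟩, key _, key _, hi _ _, hi _ _, hi _ _⟩

/-- polarization: a curvature-like additive tensor vanishing on sectional data is zero. -/
theorem aux_polar (D : V → V → V → V → ℝ) (hD : CurvatureLike D)
    (hadd : ∀ x x' y z w, D (x + x') y z w = D x y z w + D x' y z w)
    (K : V → Prop) (hK : ∀ x y, K x → K y → K (x + y))
    (h0 : ∀ x y, K x → K y → D x y y x = 0) :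
    ∀ x y z w, K x → K y → K z → K w → D x y z w = 0 := by
  obtain ⟨a1, a2, bi⟩ := hD
  have pair : ∀ x y z w, D x y z w = D z w x y := by
    intro x y z w
    linarith [bi x y z w, bi y z w x, bi z w x y, bi w x y z,
      a1 x y z w, a2 x y z w, a1 z w x y, a2 z w x y, a2 y z x w, a2 z x y w, a1 y z x w, a1 z x y w, a2 z w y x, a2 y w z x, a2 w y z x, a1 w y z x, a1 w x y z, a1 x w y z, a2 x w y z, a2 w x y z, a2 w x z y, a2 x z w y, a1 x z w y, a1 z x w y, a1 y z w x,a1 w z x y, a1 w y x z, a2 w y x z, a1 x y w z, a1 y z x w]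
  have add4 : ∀ x y z w w', D x y z (w + w') = D x y z w + D x y z w' := by
    intro x y z w w'
    have : ∀ w, D x y z w = - D w z x y := fun w => by
      rw [a2, pair]
    rw [this, this, this, hadd]; ring
  have add3 : ∀ x y z z' w, D x y (z + z') w = D x y z w + D x y z' w := by
    intro x y z z' w
    rw [a2, add4, a2 x y z, a2 x y z']; ring
  have add2 : ∀ x y y' z w, D x (y + y') z w = D x y z w + D x y' z w := by
    intro x y y' z w
    rw [a1, hadd, a1 x y, a1 x y']; ring
  have h1 : ∀ x y z, K x → K y → K z → D x y y z = 0 := by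
    intro x y z hx hy hz
    have := h0 (x + z) y (hK _ _ hx hz) hy
    rw [hadd, add4, add4, h0 x y hx hy, h0 z y hz hy] at this
    have h2 : D z y y x = D x y y z := by
      rw [pair z y y x, a1, a2]; ring
    linarith
  have h2 : ∀ x y z w, K x → K y → K z → K w → D x y z w = - D x z y w := by
    intro x y z w hx hy hz hw
    have := h1 x (y + z) w hx (hK _ _ hy hz) hw
    rw [add2, add3, add3, h1 x y w hx hy hw, h1 x z w hx hz hw] at this
    linarith
  intro x y z w hx hy hz hw
  have e1 := h2 x y z w hx hy hz hw
  have e2 := h2 y z x w hy hz hx hw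
  have e3 := h2 z x y w hz hx hy hw
  linarith [bi x y z w, a1 x y z w, a1 y z x w, a1 z x y w]

theorem aux_main (D : V → V → V → V → ℝ) (P : V →ₗ[ℝ] V) (hD : IsRiemannianPTensor P D)
    (hP2 : ∀ x : V, P (P x) = x)
    (hPg : ∀ x y : V, ⟪P x, P y⟫_ℝ = ⟪x, y⟫_ℝ)
    (hadd : ∀ x x' y z w, D (x + x') y z w = D x y z w + D x' y z w)
    (add2 : ∀ x y y' z w, D x (y + y') z w = D x y z w + D x y' z w)
    (add3 : ∀ x y z z' w, D x y (z + z') w = D x y z w + D x y z' w)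
    (add4 : ∀ x y z w w', D x y z (w + w') = D x y z w + D x y z w')
    (neg4 : ∀ x y z w, D x y z (-w) = - D x y z w)
    (hT : ∀ x y, TotallyReal P x y → D x y y x = 0 ∧ D x y y (P x) = 0)
    (iso1 : ∀ u v : V, P u = u → P v = v →
      ∃ u' v' : V, P u' = -u' ∧ P v' = -v' ∧ ⟪u', u'⟫_ℝ = ⟪u, u⟫_ℝ ∧
      ⟪u', v'⟫_ℝ = ⟪u, v⟫_ℝ ∧ ⟪v', v'⟫_ℝ = ⟪v, v⟫_ℝ)
    (iso2 : ∀ u v : V, P u = -u → P v = -v →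
      ∃ u' v' : V, P u' = u' ∧ P v' = v' ∧ ⟪u', u'⟫_ℝ = ⟪u, u⟫_ℝ ∧
      ⟪u', v'⟫_ℝ = ⟪u, v⟫_ℝ ∧ ⟪v', v'⟫_ℝ = ⟪v, v⟫_ℝ) :
    ∀ x y z w, D x y z w = 0 := by
  obtain ⟨hC, hPD⟩ := hD
  have hC' := hC
  obtain ⟨a1, a2, bi⟩ := hC
  have pair : ∀ x y z w, D x y z w = D z w x y := by
    intro x y z w
    linarith [bi x y z w, bi y z w x, bi z w x y, bi w x y z,
      a1 x y z w, a2 x y z w, a1 z w x y, a2 z w x y, a2 y z x w, a2 z x y w, a1 y z x w, a1 z x y w, a2 z w y x, a2 y w z x, a2 w y z x, a1 w y z x, a1 w x y z, a1 x w y z, a2 x w y z, a2 w x y z, a2 w x z y, a2 x z w y, a1 x z w y, a1 z x w y, a1 y z w x,a1 w z x y, a1 w y x z, a2 w y x z, a1 x y w z, a1 y z x w]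
  have m34 : ∀ x y u v, P u = u → P v = -v → D x y u v = 0 := by
    intro x y u v hu hv
    have := hPD x y u v
    rw [hu, hv, neg4] at this
    linarith
  have m43 : ∀ x y u v, P u = u → P v = -v → D x y v u = 0 := by
    intro x y u v hu hv
    rw [a2, m34 x y u v hu hv, neg_zero]
  have m12 : ∀ x y u v, P u = u → P v = -v → D u v x y = 0 := by
    intro x y u v hu hv
    rw [pair, m34 x y u v hu hv]
  have m21 : ∀ x y u v, P u = u → P v = -v → D v u x y = 0 := by
    intro x y u v hu hv
    rw [pair, m43 x y u v hu hv]
  have mpm : ∀ x y u v, P x = x → P y = y → P u = -u → P v = -v → D x y u v = 0 := by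
    intro x y u v hx hy hu hv
    linarith [bi x y u v, m12 x v y u hy hu, m21 y v x u hx hu]
  have mmp : ∀ x y u v, P x = x → P y = y → P u = -u → P v = -v → D u v x y = 0 := by
    intro x y u v hx hy hu hv
    rw [pair, mpm x y u v hx hy hu hv]
  have ort : ∀ u v, P u = u → P v = -v → ⟪u, v⟫_ℝ = 0 := by
    intro u v hu hv
    have := hPg u v
    rw [hu, hv, inner_neg_right] at this
    linarith
  have both : ∀ u v u' v', P u = u → P v = v → P u' = -u' → P v' = -v' →
      ⟪u', u'⟫_ℝ = ⟪u, u⟫_ℝ → ⟪u', v'⟫_ℝ = ⟪u, v⟫_ℝ → ⟪v', v'⟫_ℝ = ⟪v, v⟫_ℝ →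
      D u v v u = 0 ∧ D u' v' v' u' = 0 := by
    intro u v u' v' hu hv hu' hv' huu huv hvv
    have huv2 : ⟪v', u'⟫_ℝ = ⟪v, u⟫_ℝ := by
      rw [real_inner_comm, huv, real_inner_comm]
    have o1 := ort u u' hu hu'
    have o2 := ort u v' hu hv'
    have o3 := ort v u' hv hu'
    have o4 := ort v v' hv hv'
    have o1' := o1
    have o2' := o2
    have o3' := o3
    have o4' := o4
    rw [real_inner_comm] at o1' o2' o3' o4'
    have ht : TotallyReal P (u + u') (v + v') := by
      refine ⟨?_, ?_, ?_, ?_⟩ <;>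
      simp only [map_add, hu, hv, hu', hv', inner_add_left, inner_add_right, inner_neg_right,
        o1, o2, o3, o4, o1', o2', o3', o4', huu, huv, hvv, huv2] <;> ring
    obtain ⟨t1, t2⟩ := hT _ _ ht
    simp only [map_add, hu, hu', hadd, add2, add3, add4, neg4] at t1 t2
    simp only [m12 _ _ u v' hu hv', m21 _ _ v u' hv hu', m34 _ _ v u' hv hu',
      m43 _ _ u v' hu hv', mpm u v v' u' hu hv hv' hu', mmp v u u' v' hv hu hu' hv'] at t1 t2
    constructor <;> linarith
  have Kp := aux_polar D hC' hadd (fun x => P x = x)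
    (fun x y hx hy => by simp only [map_add] at *; rw [hx, hy])
    (fun u v hu hv => by
      obtain ⟨u', v', h1, h2, h3, h4, h5⟩ := iso1 u v hu hv
      exact (both u v u' v' hu hv h1 h2 h3 h4 h5).1)
  have Km := aux_polar D hC' hadd (fun x => P x = -x)
    (fun x y hx hy => by simp only [map_add] at *; rw [hx, hy]; abel)
    (fun u v hu hv => by
      obtain ⟨u', v', h1, h2, h3, h4, h5⟩ := iso2 u v hu hv
      exact (both u' v' u v h1 h2 hu hv h3.symm h4.symm h5.symm).2)
  have dec : ∀ x : V, ∃ a b, P a = a ∧ P b = -b ∧ x = a + b := by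
    intro x
    refine ⟨(1 / 2 : ℝ) • (x + P x), (1 / 2 : ℝ) • (x - P x), ?_, ?_, ?_⟩
    · simp [hP2, add_comm]
    · simp only [map_smul, map_sub, hP2]; rw [← smul_neg]; congr 1; abel
    · module
  intro x y z w
  obtain ⟨x1, x2, hx1, hx2, rfl⟩ := dec x
  obtain ⟨y1, y2, hy1, hy2, rfl⟩ := dec y
  obtain ⟨z1, z2, hz1, hz2, rfl⟩ := dec z
  obtain ⟨w1, w2, hw1, hw2, rfl⟩ := dec w
  simp only [hadd, add2, add3, add4]
  simp only [m12 _ _ x1 y2 hx1 hy2, m21 _ _ y1 x2 hy1 hx2, m34 _ _ z1 w2 hz1 hw2,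
    m43 _ _ w1 z2 hw1 hz2, mpm x1 y1 z2 w2 hx1 hy1 hz2 hw2, mmp z1 w1 x2 y2 hz1 hw1 hx2 hy2,
    Kp x1 y1 z1 w1 hx1 hy1 hz1 hw1, Km x2 y2 z2 w2 hx2 hy2 hz2 hw2]
  norm_num

theorem aux_pi1_ne (x y : V) (h : LinearIndependent ℝ ![x, y]) : pi1 x y y x ≠ 0 := by
  intro h0
  have hx : x ≠ 0 := by simpa using h.ne_zero 0
  have hxx : ⟪x, x⟫_ℝ ≠ 0 := by simpa using hx
  have hw : ⟪x, x⟫_ℝ • y - ⟪x, y⟫_ℝ • x = 0 := by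
    rw [← inner_self_eq_zero (𝕜 := ℝ)]
    simp only [pi1, psi1] at h0
    simp only [inner_sub_left, inner_sub_right, real_inner_smul_left, real_inner_smul_right,
      real_inner_comm x y] at h0 ⊢
    linear_combination ⟪x, x⟫_ℝ * h0
  rw [LinearIndependent.pair_iff] at h
  exact hxx (h (-⟪x, y⟫_ℝ) ⟪x, x⟫_ℝ (by rw [← hw]; module)).2

/-- pointwise algebraic form of Theorem 5.2.
A Riemannian P-tensor `R'` has the point-wise constant totally real sectional curvatures
`ν' = τ'/(4n(n−1))` and `ν'* = τ'*/(4n(n−1))` iff `C(R') = 0`. -/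
theorem stmt_9
    [FiniteDimensional ℝ V] (n : ℕ) (hn : 2 ≤ n)
    (hdim : Module.finrank ℝ V = 2 * n)
    (P : V →ₗ[ℝ] V) (hP2 : ∀ x : V, P (P x) = x)
    (hPg : ∀ x y : V, ⟪P x, P y⟫_ℝ = ⟪x, y⟫_ℝ)
    (hPtr : LinearMap.trace ℝ V P = 0)
    (e : OrthonormalBasis (Fin (2 * n)) ℝ V)
    (R' : V →ₗ[ℝ] V →ₗ[ℝ] V →ₗ[ℝ] V →ₗ[ℝ] ℝ)
    (hR' : IsRiemannianPTensor P (fun x y z w => R' x y z w)) :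
    (∀ x y : V, LinearIndependent ℝ ![x, y] → TotallyReal P x y →
        R' x y y x / pi1 x y y x
          = tau e (fun a b c d => R' a b c d) / (4 * (n : ℝ) * ((n : ℝ) - 1)) ∧
        R' x y y (P x) / pi1 x y y x
          = tauStar e P (fun a b c d => R' a b c d) / (4 * (n : ℝ) * ((n : ℝ) - 1)))
      ↔ (∀ x y z w : V, Ctens n e P (fun a b c d => R' a b c d) x y z w = 0) := by
  have hsw : ∀ x y : V, ⟪P x, y⟫_ℝ = ⟪x, P y⟫_ℝ := fun x y => by
    rw [← hPg x (P y), hP2]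
  have hPP : ∀ x y : V, ⟪x, P y⟫_ℝ = ⟪y, P x⟫_ℝ := fun x y => by
    rw [← hsw, real_inner_comm]
  set a := tau e (fun a b c d => R' a b c d) with ha
  set b := tauStar e P (fun a b c d => R' a b c d) with hb
  set k : ℝ := 4 * (n : ℝ) * ((n : ℝ) - 1) with hk
  have p1 : ∀ x y, TotallyReal P x y → Ctens n e P (fun a b c d => R' a b c d) x y y x
      = R' x y y x - a / k * pi1 x y y x := by
    rintro x y ⟨h1, h2, h3, h4⟩
    simp only [Ctens, pi1, pi2, pi3, psi2, psi1, h1, h2, h3, h4, ← ha, ← hb, ← hk]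
    ring
  have p2 : ∀ x y, TotallyReal P x y → Ctens n e P (fun a b c d => R' a b c d) x y y (P x)
      = R' x y y (P x) - b / k * pi1 x y y x := by
    rintro x y ⟨h1, h2, h3, h4⟩
    simp only [Ctens, pi1, pi2, pi3, psi2, psi1, hP2, h1, h2, h3, h4, ← ha, ← hb, ← hk]
    ring
  constructor
  · intro H
    have hdep : ∀ x y z w, ¬ LinearIndependent ℝ ![x, y] →
        Ctens n e P (fun a b c d => R' a b c d) x y z w = 0 := by
      intro x y z w h
      have hxx : ∀ x z w, R' x x z w = 0 := fun x z w => by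
        have := hR'.1.1 x x z w
        simp only at this
        linarith
      by_cases hx : x = 0
      · subst hx
        simp [Ctens, pi1, pi2, pi3, psi2, psi1]
      · rw [LinearIndependent.pair_iff' hx] at h
        push Not at h
        obtain ⟨c, rfl⟩ := h
        simp only [Ctens, pi1, pi2, pi3, psi2, psi1, map_smul, LinearMap.smul_apply, hxx,
          real_inner_smul_left, smul_zero]
        ring
    obtain ⟨⟨c1, c2, c3⟩, c4⟩ := hR'
    simp only at c1 c2 c3 c4
    refine aux_main _ P ⟨⟨?_, ?_, ?_⟩, ?_⟩ hP2 hPg ?_ ?_ ?_ ?_ ?_ ?_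
      (aux_isometry n hdim P hP2 hPtr) ?_
    · intro x y z w
      simp only [Ctens, pi1, pi2, pi3, psi2, psi1]
      rw [c1 x y z w]; ring
    · intro x y z w
      simp only [Ctens, pi1, pi2, pi3, psi2, psi1]
      rw [c2 x y z w]; ring
    · intro x y z w
      simp only [Ctens, pi1, pi2, pi3, psi2, psi1]
      rw [real_inner_comm x y, real_inner_comm z x, real_inner_comm y z,
        hPP y x, hPP z x, hPP z y]
      linear_combination c3 x y z w
    · intro x y z w
      simp only [Ctens, pi1, pi2, pi3, psi2, psi1, hP2]
      rw [c4 x y z w]; ring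
    · intro x x' y z w
      simp only [Ctens, pi1, pi2, pi3, psi2, psi1, map_add, LinearMap.add_apply, inner_add_left]
      ring
    · intro x y y' z w
      simp only [Ctens, pi1, pi2, pi3, psi2, psi1, map_add, LinearMap.add_apply, inner_add_left]
      ring
    · intro x y z z' w
      simp only [Ctens, pi1, pi2, pi3, psi2, psi1, map_add, LinearMap.add_apply, inner_add_right]
      ring
    · intro x y z w w'
      simp only [Ctens, pi1, pi2, pi3, psi2, psi1, map_add, inner_add_right]
      ring
    · intro x y z w
      simp only [Ctens, pi1, pi2, pi3, psi2, psi1, map_neg, inner_neg_right]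
      ring
    · intro x y ht
      by_cases hl : LinearIndependent ℝ ![x, y]
      · have hne := aux_pi1_ne x y hl
        obtain ⟨q1, q2⟩ := H x y hl ht
        rw [div_eq_iff hne] at q1 q2
        rw [p1 x y ht, p2 x y ht, q1, q2]
        simp
      · exact ⟨hdep _ _ _ _ hl, hdep _ _ _ _ hl⟩
    · intro u v hu hv
      obtain ⟨u', v', h1, h2, h3⟩ := aux_isometry n hdim (-P) (by simp [hP2]) (by simp [hPtr]) u v
        (by simp [hu]) (by simp [hv])
      exact ⟨u', v', by simpa using h1, by simpa using h2, h3⟩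
  · intro H x y hl ht
    have hne := aux_pi1_ne x y hl
    rw [div_eq_iff hne, div_eq_iff hne]
    have q1 := H x y y x
    have q2 := H x y y (P x)
    rw [p1 x y ht] at q1
    rw [p2 x y ht] at q2
    constructor <;> linarith
end
end

section
/- Let R' be a Riemannian P-tensor on V (n ≥ 1). Then E(R') = 0 if and only if R' = 0. Equivalently: a Riemannian P-tensor which is a scalar multiple of π₁ must vanish. (Pointwise algebraic form of Theorem 6.2: the connection D with parallel torsion is flat if and only if E(R') = 0.) -/
open scoped InnerProductSpace

noncomputable section

variable {V : Type*} [NormedAddCommGroup V] [InnerProductSpace ℝ V]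

/-- pointwise algebraic form of Theorem 6.2.
For a Riemannian P-tensor `R'` (n ≥ 1): `E(R') = 0` iff `R' = 0`; equivalently,
a Riemannian P-tensor which is a scalar multiple of `π₁` must vanish. -/
theorem stmt_12
    [FiniteDimensional ℝ V] (n : ℕ) (hn : 1 ≤ n)
    (hdim : Module.finrank ℝ V = 2 * n)
    (P : V →ₗ[ℝ] V) (hP2 : ∀ x : V, P (P x) = x)
    (hPg : ∀ x y : V, ⟪P x, P y⟫_ℝ = ⟪x, y⟫_ℝ)
    (hPtr : LinearMap.trace ℝ V P = 0)
    (e : OrthonormalBasis (Fin (2 * n)) ℝ V)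
    (R' : V →ₗ[ℝ] V →ₗ[ℝ] V →ₗ[ℝ] V →ₗ[ℝ] ℝ)
    (hR' : IsRiemannianPTensor P (fun x y z w => R' x y z w)) :
    ((∀ x y z w : V, Etens n e (fun a b c d => R' a b c d) x y z w = 0)
        ↔ (∀ x y z w : V, R' x y z w = 0)) ∧
    (∀ c : ℝ, (∀ x y z w : V, R' x y z w = c * pi1 x y z w) →
        ∀ x y z w : V, R' x y z w = 0) := by
  have hn' : (n : ℝ) ≠ 0 := by
    have : n ≠ 0 := by omega
    exact_mod_cast this
  have htr1 : LinearMap.trace ℝ V LinearMap.id = 2 * (n : ℝ) := by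
    rw [LinearMap.trace_id, hdim]; push_cast; ring
  have hu : ∃ u : V, u ≠ 0 ∧ P u = u := by
    by_contra hcon
    push Not at hcon
    have hP : P = -LinearMap.id := by
      ext x
      by_contra hx
      refine hcon (x + P x) ?_ ?_
      · intro h0
        apply hx
        simpa using (neg_eq_of_add_eq_zero_right h0).symm
      · rw [map_add, hP2, add_comm]
    rw [hP, map_neg, htr1] at hPtr
    apply hn'; linarith
  have hv : ∃ v : V, v ≠ 0 ∧ P v = -v := by
    by_contra hcon
    push Not at hcon
    have hP : P = LinearMap.id := by
      ext x
      by_contra hx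
      refine hcon (x - P x) ?_ ?_
      · intro h0
        apply hx
        simpa using (sub_eq_zero.mp h0).symm
      · rw [map_sub, hP2, neg_sub]
    rw [hP, htr1] at hPtr
    apply hn'; linarith
  obtain ⟨u, hu0, hPu⟩ := hu
  obtain ⟨v, hv0, hPv⟩ := hv
  have horth : ⟪u, v⟫_ℝ = 0 := by
    have h := hPg u v
    rw [hPu, hPv, inner_neg_right] at h
    linarith
  have key : ∀ c : ℝ, (∀ x y z w : V, R' x y z w = c * pi1 x y z w) →
      ∀ x y z w : V, R' x y z w = 0 := by
    intro c hc
    have h1 : R' u v v u = 0 := by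
      have h := hR'.2 u v v u
      simp only [hPu, hPv, map_neg, LinearMap.neg_apply] at h
      linarith
    have h2 : pi1 u v v u = ⟪v, v⟫_ℝ * ⟪u, u⟫_ℝ := by
      unfold pi1 psi1
      simp only [horth]; ring
    have hc0 : c = 0 := by
      rw [hc, h2] at h1
      have a : ⟪v, v⟫_ℝ ≠ 0 := inner_self_ne_zero.mpr hv0
      have b : ⟪u, u⟫_ℝ ≠ 0 := inner_self_ne_zero.mpr hu0
      exact (mul_eq_zero.mp h1).resolve_right (mul_ne_zero a b)
    intro x y z w
    rw [hc, hc0, zero_mul]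
  refine ⟨⟨fun h => key _ fun x y z w => sub_eq_zero.mp (h x y z w), fun h x y z w => ?_⟩, key⟩
  simp [Etens, tau, ricci, h]
end
end
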